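/- Let n ≥ 5 and let G be a transitive, imprimitive permutation group of rank 3 on a finite set Ω, with a nontrivial system of imprimitivity 𝓑 consisting of n blocks. Suppose G is block-faithful with respect to 𝓑 and that the induced permutation group G^𝓑 ≤ Sym(𝓑) contains the alternating group Alt(𝓑) (so G^𝓑 is the natural alternating or symmetric group of degree n). Then no such G exists; i.e., these hypotheses are contradictory. -/

import Mathlib

/-- A `G`-invariant partition of `Ω` (a system of imprimitivity, possibly trivial). -/
def IsBlockSystem {Ω : Type*} (G : Subgroup (Equiv.Perm Ω)) (P : Set (Set Ω)) : Prop :=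
  Setoid.IsPartition P ∧ ∀ g ∈ G, ∀ S ∈ P, (⇑g '' S) ∈ P

/-- A partition is nontrivial if it is neither the partition into singletons nor `{Ω}`. -/
def IsNontrivialSystem {Ω : Type*} (P : Set (Set Ω)) : Prop :=
  (∃ S ∈ P, ¬ S.Subsingleton) ∧ (∃ S ∈ P, S ≠ Set.univ)

section BlockAction

open Equiv Equiv.Perm

variable {Ω X G : Type*} [Group G] [MulAction G Ω] {π : G →* Perm X} {b : Ω → X}

/-- The stabiliser of `x` in `G` acts on the fibre of `b` over `x`. -/
def fiberHom (hb : ∀ g p, b (g • p) = π g (b p)) (x : X) {A : Type*} [Group A] (ψ : A →* G)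
    (hψ : ∀ a, π (ψ a) x = x) : A →* Perm {p // b p = x} where
  toFun a := (MulAction.toPerm (ψ a) : Perm Ω).subtypePerm fun p => by
    rw [MulAction.toPerm_apply, hb]
    exact ⟨fun h => (π (ψ a)).injective (h.trans (hψ a).symm), fun h => by rw [h, hψ]⟩
  map_one' := by ext p; simp
  map_mul' a a' := Equiv.ext fun p => Subtype.ext (by
    change ψ (a * a') • (p : Ω) = ψ a • ψ a' • (p : Ω)
    rw [map_mul, mul_smul])

theorem fiberHom_apply_coe (hb : ∀ g p, b (g • p) = π g (b p)) (x : X) {A : Type*} [Group A]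
    (ψ : A →* G) (hψ : ∀ a, π (ψ a) x = x) (a : A) (p : {p // b p = x}) :
    (fiberHom hb x ψ hψ a p : Ω) = ψ a • (p : Ω) := rfl

/-- Any two ordered pairs of points in distinct fibres are conjugate under `G`. -/
def CrossTransitive (G : Type*) [Group G] [MulAction G Ω] (b : Ω → X) : Prop :=
  ∀ p q p' q' : Ω, b p ≠ b q → b p' ≠ b q' → ∃ g : G, g • p = p' ∧ g • q = q'

theorem CrossTransitive.card_fiber_eq [Finite Ω] (hpair : CrossTransitive G b)
    (hb : ∀ g p, b (g • p) = π g (b p)) (hsurj : b.Surjective) [Nontrivial X] (x y : X) :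
    Nat.card {p // b p = x} = Nat.card {p // b p = y} := by
  obtain ⟨x', hx⟩ := exists_ne x
  obtain ⟨y', hy⟩ := exists_ne y
  obtain ⟨p, rfl⟩ := hsurj x
  obtain ⟨q, rfl⟩ := hsurj y
  obtain ⟨p', rfl⟩ := hsurj x'
  obtain ⟨q', rfl⟩ := hsurj y'
  obtain ⟨g, hg, -⟩ := hpair p p' q q' hx.symm hy.symm
  refine Nat.card_congr ((MulAction.toPerm g : Perm Ω).subtypeEquiv fun r => ?_)
  rw [MulAction.toPerm_apply, hb, ← hg, hb, (π g).injective.eq_iff]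

theorem crossTransitive_of_card_orbits_le_three (hb : ∀ g p, b (g • p) = π g (b p))
    [Finite Ω] (hrank : Nat.card (MulAction.orbitRel.Quotient G (Ω × Ω)) ≤ 3)
    (hninj : ¬ b.Injective) :
    CrossTransitive G b := by
  intro p q p' q' hpq hpq'
  by_contra! hno
  obtain ⟨r, r', hr, hrr⟩ : ∃ r r', b r = b r' ∧ r ≠ r' := by
    simpa [Function.Injective] using hninj
  let f : Fin 4 → Ω × Ω := ![(r, r), (r, r'), (p, q), (p', q')]
  have horb : ∀ u v : Ω × Ω, (⟦u⟧ : MulAction.orbitRel.Quotient G (Ω × Ω)) = ⟦v⟧ →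
      ∃ g : G, g • v.1 = u.1 ∧ g • v.2 = u.2 := fun u v h => by
    obtain ⟨g, hg⟩ := Quotient.exact h
    exact ⟨g, congrArg Prod.fst hg, congrArg Prod.snd hg⟩
  have hdiag : ∀ u v : Ω × Ω, (⟦u⟧ : MulAction.orbitRel.Quotient G (Ω × Ω)) = ⟦v⟧ →
      (u.1 = u.2 ↔ v.1 = v.2) := fun u v h => by
    obtain ⟨g, h1, h2⟩ := horb u v h
    rw [← h1, ← h2, smul_left_cancel_iff]
  have hblock : ∀ u v : Ω × Ω, (⟦u⟧ : MulAction.orbitRel.Quotient G (Ω × Ω)) = ⟦v⟧ →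
      (b u.1 = b u.2 ↔ b v.1 = b v.2) := fun u v h => by
    obtain ⟨g, h1, h2⟩ := horb u v h
    rw [← h1, ← h2, hb, hb, (π g).injective.eq_iff]
  have hlast : (⟦(p', q')⟧ : MulAction.orbitRel.Quotient G (Ω × Ω)) ≠ ⟦(p, q)⟧ := fun h => by
    obtain ⟨g, h1, h2⟩ := horb _ _ h
    exact hno g h1 h2
  have hf : Function.Injective
      fun i => (⟦f i⟧ : MulAction.orbitRel.Quotient G (Ω × Ω)) := by
    intro i j hij
    have hd := hdiag _ _ hij
    have hbl := hblock _ _ hij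
    fin_cases i <;> fin_cases j <;> first
      | rfl
      | exact absurd hij hlast
      | exact absurd hij.symm hlast
      | simp [f, hr, hrr, hpq, hpq'] at hd hbl
  have h4 := (Nat.card_le_card_of_injective _ hf).trans hrank
  rw [Nat.card_fin] at h4
  omega

variable [Fintype Ω] [Fintype X] [DecidableEq X]

theorem card_fiber_le (hinj : Function.Injective π) (hb : ∀ g p, b (g • p) = π g (b p))
    (hsurj : b.Surjective) (halt : alternatingGroup X ≤ π.range) (hX : 3 ≤ Nat.card X)
    (hpair : CrossTransitive G b) (x : X) :
    Nat.card {p // b p = x} ≤ Nat.card X - 2 := by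
  classical
  have : Nontrivial X := Finite.one_lt_card_iff_nontrivial.mp (by omega)
  obtain ⟨x₂, h12⟩ := exists_ne x
  obtain ⟨x₃, h3⟩ : ∃ y, y ∉ ({x, x₂} : Finset X) := by
    by_contra! h
    have := Finset.card_le_card (fun y _ => h y : (Finset.univ : Finset X) ⊆ _)
    have := Finset.card_le_two (a := x) (b := x₂)
    simp only [Finset.card_univ, ← Nat.card_eq_fintype_card] at *
    omega
  simp only [Finset.mem_insert, Finset.mem_singleton, not_or] at h3
  obtain ⟨h31, h32⟩ := h3
  obtain ⟨γ, hγ⟩ : swap x x₂ * swap x x₃ ∈ π.range :=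
    halt ((isThreeCycle_swap_mul_swap_same h12.symm (Ne.symm h31) (Ne.symm h32)).mem_alternatingGroup)
  have hγ3 : π γ x = x₃ := by
    rw [hγ]; simp [swap_apply_of_ne_of_ne, h31, h32]
  have hcomm : ∀ h : G, π h x = x → π h x₂ = x₂ → π h x₃ = x₃ → γ * h = h * γ := by
    intro h h1 h2 h3
    apply hinj
    rw [map_mul, map_mul, hγ, ← mul_assoc (π h), mul_swap_eq_swap_mul (π h), h1, h2,
      mul_assoc, mul_assoc, mul_swap_eq_swap_mul (π h), h1, h3]
  obtain ⟨α, hα⟩ := hsurj x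
  have hγα : b (γ • α) = x₃ := by rw [hb, hα, hγ3]
  -- `k y` is an element fixing `x` and `x₃` that moves `x₂` to `y`
  have hk : ∀ y, ∃ k : G, (∃ g, π g x = x ∧ π g x₃ = x₃ ∧ π g x₂ = y) →
      π k x = x ∧ π k x₃ = x₃ ∧ π k x₂ = y := fun y => by
    by_cases h : ∃ g, π g x = x ∧ π g x₃ = x₃ ∧ π g x₂ = y
    · exact ⟨h.choose, fun _ => h.choose_spec⟩
    · exact ⟨1, fun h' => absurd h' h⟩
  choose k hk using hk
  let B : X → Finset Ω := fun z => Finset.univ.filter (b · = z)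
  have hBcard : ∀ z, (B z).card = Nat.card {p // b p = z} := fun z => by
    rw [Nat.card_eq_fintype_card, Fintype.card_subtype]
  have hsub : B x ×ˢ B x₃ ⊆ ((({x, x₃} : Finset X)ᶜ) ×ˢ B x).image
      fun yβ => (k yβ.1 • yβ.2, k yβ.1 • γ • yβ.2) := by
    rintro ⟨p, q⟩ hpq
    simp only [B, Finset.mem_product, Finset.mem_filter, Finset.mem_univ, true_and] at hpq
    obtain ⟨hp, hq⟩ := hpq
    obtain ⟨g, hgp, hgq⟩ := hpair α (γ • α) p q (by rw [hα, hγα]; exact Ne.symm h31)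
      (by rw [hp, hq]; exact Ne.symm h31)
    have g1 : π g x = x := by rw [← hα, ← hb, hgp, hp, hα]
    have g3 : π g x₃ = x₃ := by rw [← hγα, ← hb, hgq, hq, hγα]
    obtain ⟨k1, k3, k2⟩ := hk (π g x₂) ⟨g, g1, g3, rfl⟩
    have hc := hcomm ((k (π g x₂))⁻¹ * g)
      (by rw [map_mul, Perm.mul_apply, g1, map_inv, inv_eq_iff_eq, k1])
      (by rw [map_mul, Perm.mul_apply, map_inv, inv_eq_iff_eq, k2])
      (by rw [map_mul, Perm.mul_apply, g3, map_inv, inv_eq_iff_eq, k3])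
    simp only [Finset.mem_image, Finset.mem_product, Prod.exists, Prod.mk.injEq]
    refine ⟨π g x₂, ((k (π g x₂))⁻¹ * g) • α, ⟨?_, ?_⟩, ?_, ?_⟩
    · simp only [Finset.mem_compl, Finset.mem_insert, Finset.mem_singleton, not_or]
      exact ⟨fun h => h12 ((π g).injective (h.trans g1.symm)),
        fun h => h32 ((π g).injective (h.trans g3.symm)).symm⟩
    · simp only [B, Finset.mem_filter, Finset.mem_univ, true_and]
      rw [hb, hα, map_mul, Perm.mul_apply, g1, map_inv, inv_eq_iff_eq, k1]
    · rw [smul_smul, mul_inv_cancel_left, hgp]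
    · rw [smul_smul γ, hc, mul_smul, smul_smul, mul_inv_cancel_left, hgq]
  have hle := (Finset.card_le_card hsub).trans Finset.card_image_le
  rw [Finset.card_product, Finset.card_product, Finset.card_compl, Finset.card_pair (Ne.symm h31),
    hBcard, hBcard, hpair.card_fiber_eq hb hsurj x₃ x, ← Nat.card_eq_fintype_card] at hle
  exact Nat.le_of_mul_le_mul_right hle (Nat.card_pos_iff.mpr ⟨⟨α, hα⟩, inferInstance⟩)

theorem card_fiber_sq_dvd (hinj : Function.Injective π) (hb : ∀ g p, b (g • p) = π g (b p))
    (hsurj : b.Surjective) (hX : 2 ≤ Nat.card X) (hpair : CrossTransitive G b) (x : X) :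
    Nat.card {p // b p = x} * Nat.card {p // b p = x} ∣ (Nat.card X - 2).factorial := by
  classical
  have : Nontrivial X := Finite.one_lt_card_iff_nontrivial.mp (by omega)
  obtain ⟨y, hy⟩ := exists_ne x
  obtain ⟨α, hα⟩ := hsurj x
  obtain ⟨β, hβ⟩ := hsurj y
  have : Finite G := Finite.of_injective π hinj
  let L : Subgroup G := (MulAction.stabilizer (Perm X) x ⊓ MulAction.stabilizer (Perm X) y).comap π
  have hL : ∀ g, g ∈ L ↔ π g x = x ∧ π g y = y := fun g => Iff.rfl
  have horb : Nat.card (MulAction.orbit L (α, β)) =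
      Nat.card {p // b p = x} * Nat.card {p // b p = x} := by
    conv_rhs => rw [hpair.card_fiber_eq hb hsurj x x]; arg 2; rw [hpair.card_fiber_eq hb hsurj x y]
    rw [← Nat.card_prod]
    have : MulAction.orbit L (α, β) = {p | b p = x} ×ˢ {p | b p = y} := by
      ext ⟨p, q⟩
      constructor
      · rintro ⟨⟨g, hg⟩, h⟩
        obtain ⟨rfl, rfl⟩ := Prod.mk.inj h
        obtain ⟨h1, h2⟩ := (hL g).mp hg
        exact ⟨(hb g α).trans (by rw [hα, h1]), (hb g β).trans (by rw [hβ, h2])⟩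
      · rintro ⟨hp, hq⟩
        have hp : b p = x := hp
        have hq : b q = y := hq
        obtain ⟨g, h1, h2⟩ := hpair α β p q (by rw [hα, hβ]; exact hy.symm)
          (by rw [hp, hq]; exact hy.symm)
        refine ⟨⟨g, (hL g).mpr ⟨?_, ?_⟩⟩, Prod.ext h1 h2⟩
        · rw [← hα, ← hb, h1, hp, hα]
        · rw [← hβ, ← hb, h2, hq, hβ]
    rw [this]
    exact Nat.card_congr (Equiv.Set.prod _ _)
  have hdvd : Nat.card (MulAction.orbit L (α, β)) ∣ Nat.card L := by
    rw [Nat.card_congr (MulAction.orbitEquivQuotientStabilizer L (α, β))]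
    exact Subgroup.card_quotient_dvd_card _
  rw [horb] at hdvd
  refine hdvd.trans ?_
  have hmem : ∀ g ∈ L, ∀ z, z ∉ ({x, y} : Finset X) ↔ π g z ∉ ({x, y} : Finset X) := by
    intro g hg z
    obtain ⟨h1, h2⟩ := (hL g).mp hg
    have h1' : π g z = x ↔ z = x := by conv_lhs => rw [← h1, (π g).injective.eq_iff]
    have h2' : π g z = y ↔ z = y := by conv_lhs => rw [← h2, (π g).injective.eq_iff]
    simp [h1', h2']
  let θ : L →* Perm {z // z ∉ ({x, y} : Finset X)} :=
    { toFun := fun g => (π g).subtypePerm fun z => (hmem g g.2 z).symm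
      map_one' := by ext; simp
      map_mul' := fun g h => Equiv.ext fun z => Subtype.ext (by
        change π (g * h : G) z = π g (π h z)
        rw [map_mul, Perm.mul_apply]) }
  have hθ : Function.Injective θ := by
    rw [injective_iff_map_eq_one]
    rintro ⟨g, hg⟩ h
    obtain ⟨h1, h2⟩ := (hL g).mp hg
    refine Subtype.ext (hinj ?_)
    rw [Subgroup.coe_one, map_one]
    ext z
    by_cases hz : z ∈ ({x, y} : Finset X)
    · rcases Finset.mem_insert.mp hz with rfl | hz
      · exact h1
      · rw [Finset.mem_singleton.mp hz]; exact h2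
    · exact congrArg Subtype.val (DFunLike.congr_fun h ⟨z, hz⟩)
  have hc := Subgroup.card_dvd_of_injective θ hθ
  rwa [Nat.card_perm, Nat.card_eq_fintype_card (α := {z // z ∉ _}), Fintype.card_subtype_compl,
    Fintype.card_coe, Finset.card_pair hy.symm, ← Nat.card_eq_fintype_card] at hc

theorem smul_eq_of_even_of_fixes (hb : ∀ g p, b (g • p) = π g (b p))
    (hinj : Function.Injective π) (halt : alternatingGroup X ≤ π.range) (hX : 6 ≤ Nat.card X)
    {x : X} (hle : Nat.card {p // b p = x} ≤ Nat.card X - 2) (g : G)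
    (hg : π g ∈ alternatingGroup X) (hgx : π g x = x) (p : Ω) (hp : b p = x) : g • p = p := by
  classical
  let ρ : alternatingGroup X →* G :=
    (MonoidHom.ofInjective hinj).symm.toMonoidHom.comp (Subgroup.inclusion halt)
  have hρ : ∀ σ, π (ρ σ) = σ := fun σ => by
    have := (MonoidHom.ofInjective hinj).apply_symm_apply (Subgroup.inclusion halt σ)
    exact congrArg Subtype.val this
  let s : Finset X := Finset.univ.erase x
  have hs : Nat.card s = Nat.card X - 1 := by
    rw [Nat.card_eq_fintype_card, Fintype.card_coe, Finset.card_erase_of_mem (Finset.mem_univ x),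
      Finset.card_univ, Nat.card_eq_fintype_card]
  have hfix : ∀ a, π (ρ.comp (alternatingGroup.ofSubtype s) a) x = x := fun a => by
    rw [MonoidHom.comp_apply, hρ, alternatingGroup.coe_ofSubtype]
    exact Perm.ofSubtype_apply_of_not_mem _ (by simp [s])
  let φ := fiberHom hb x (ρ.comp (alternatingGroup.ofSubtype s)) hfix
  have : IsSimpleGroup (alternatingGroup s) := alternatingGroup.isSimpleGroup (by omega)
  have : Nontrivial s := Finite.one_lt_card_iff_nontrivial.mp (by omega)
  rcases (MonoidHom.normal_ker φ).eq_bot_or_eq_top with h | h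
  · exfalso
    have h1 := Nat.card_le_card_of_injective φ ((MonoidHom.ker_eq_bot_iff φ).mp h)
    have h2 := two_mul_nat_card_alternatingGroup (α := s)
    rw [Nat.card_perm] at h1 h2
    have h3 := Nat.factorial_le hle
    rw [hs, show Nat.card X - 1 = (Nat.card X - 2) + 1 by omega, Nat.factorial_succ] at h2
    have h4 := (Nat.card X - 2).factorial_pos
    have h5 : 5 * (Nat.card X - 2).factorial ≤
        (Nat.card X - 2 + 1) * (Nat.card X - 2).factorial := Nat.mul_le_mul_right _ (by omega)
    omega
  · obtain ⟨a, ha⟩ : (⟨π g, hg⟩ : alternatingGroup X) ∈ (alternatingGroup.ofSubtype s).range := by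
      rw [alternatingGroup.mem_range_ofSubtype_iff]
      intro z hz
      refine Finset.mem_erase.mpr ⟨?_, Finset.mem_univ _⟩
      rintro rfl
      exact Perm.mem_support.mp hz hgx
    have hga : ρ (alternatingGroup.ofSubtype s a) = g := hinj (by rw [hρ, ha])
    have ha' : φ a = 1 := MonoidHom.mem_ker.mp (h ▸ Subgroup.mem_top a)
    have := fiberHom_apply_coe hb x (ρ.comp (alternatingGroup.ofSubtype s)) hfix a ⟨p, hp⟩
    rw [MonoidHom.comp_apply, hga] at this
    rw [← this]
    exact congrArg Subtype.val (DFunLike.congr_fun ha' ⟨p, hp⟩)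

/-- A faithful action of an alternating or symmetric group on at least five blocks which is
transitive on pairs of points in distinct blocks has singleton blocks. -/
theorem CrossTransitive.injective (hinj : Function.Injective π)
    (hb : ∀ g p, b (g • p) = π g (b p)) (hsurj : b.Surjective)
    (halt : alternatingGroup X ≤ π.range) (hX : 5 ≤ Nat.card X) (hpair : CrossTransitive G b) :
    Function.Injective b := by
  have : Nontrivial X := Finite.one_lt_card_iff_nontrivial.mp (by omega)
  intro p p' hpp
  by_contra hne
  have hle := card_fiber_le hinj hb hsurj halt (by omega) hpair
  have hgt : ∀ x, 1 < Nat.card {q // b q = x} := fun x => by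
    rw [hpair.card_fiber_eq hb hsurj x (b p)]
    exact Finite.one_lt_card_iff_nontrivial.mpr
      ⟨⟨p, rfl⟩, ⟨p', hpp.symm⟩, fun h => hne (congrArg Subtype.val h)⟩
  rcases hX.eq_or_lt with h5 | h6
  · have hdvd := card_fiber_sq_dvd hinj hb hsurj (by omega) hpair (b p)
    have h1 := hle (b p)
    have h2 := hgt (b p)
    rw [← h5] at hdvd h1
    generalize Nat.card {q // b q = b p} = m at *
    have : m = 2 ∨ m = 3 := by omega
    rcases this with rfl | rfl <;> revert hdvd <;> decide
  · obtain ⟨y, hy⟩ := exists_ne (b p)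
    obtain ⟨⟨q, hq⟩, ⟨q', hq'⟩, hqq⟩ := Finite.one_lt_card_iff_nontrivial.mp (hgt y)
    have hfix := fun x => smul_eq_of_even_of_fixes hb hinj halt h6 (hle x)
    have hpq : b p ≠ b q := by rw [hq]; exact hy.symm
    obtain ⟨g₁, h1p, h1q⟩ := hpair p q p' q hpq (hpp ▸ hpq)
    obtain ⟨g₂, h2p, h2q⟩ := hpair p q p q' hpq (by rw [hq', ← hq]; exact hpq)
    have e1p : π g₁ (b p) = b p := by rw [← hb, h1p, hpp]
    have e1q : π g₁ (b q) = b q := by rw [← hb, h1q]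
    have e2p : π g₂ (b p) = b p := by rw [← hb, h2p]
    have e2q : π g₂ (b q) = b q := by rw [← hb, h2q, hq, hq']
    have s1 : sign (π g₁) ≠ 1 := fun h =>
      hne ((hfix _ g₁ (mem_alternatingGroup.mpr h) e1p p rfl).symm.trans h1p)
    have s2 : sign (π g₂) ≠ 1 := fun h =>
      hqq (Subtype.ext ((hfix _ g₂ (mem_alternatingGroup.mpr h) e2q q rfl).symm.trans h2q))
    have hmem : π (g₁ * g₂) ∈ alternatingGroup X := by
      rw [mem_alternatingGroup, map_mul, map_mul, (Int.units_eq_one_or _).resolve_left s1,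
        (Int.units_eq_one_or _).resolve_left s2]
      rfl
    have := hfix _ _ hmem (by rw [map_mul, Perm.mul_apply, e2p, e1p]) p rfl
    rw [mul_smul, h2p, h1p] at this
    exact hne this.symm

end BlockAction


/-- let `n ≥ 5` and let `G` be a transitive, imprimitive rank 3 group on
a finite set `Ω` with a nontrivial system of imprimitivity `P` consisting of `n`
blocks. If `G` is block-faithful with respect to `P` and the induced group `G^P`
contains the alternating group `Alt(P)`, then a contradiction follows: no such `G`
exists. -/
theorem stmt_18 {Ω : Type*} [Fintype Ω] (G : Subgroup (Equiv.Perm Ω))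
    (P : Set (Set Ω)) [Fintype ↥P] [DecidableEq ↥P] {n : ℕ} (hn : 5 ≤ n)
    (hcard : Nat.card ↥P = n)
    (htrans : ∀ p q : Ω, ∃ g ∈ G, g p = q)
    (hrank3 : Nat.card (MulAction.orbitRel.Quotient G (Ω × Ω)) = 3)
    (hblocks : IsBlockSystem G P) (hnontriv : IsNontrivialSystem P)
    (hfaithful : ∀ g ∈ G, (∀ S ∈ P, ⇑g '' S = S) → g = 1)
    (halt : ∀ σ : Equiv.Perm ↥P, σ ∈ alternatingGroup ↥P →
      ∃ g ∈ G, ∀ S : ↥P, ⇑g '' (S : Set Ω) = ((σ S : Set Ω))) :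
    False := by
  classical
  obtain ⟨⟨hempty, hpart⟩, hinv⟩ := hblocks
  choose B hB hBuniq using hpart
  let b : Ω → P := fun p => ⟨B p, (hB p).1⟩
  have hbmem : ∀ p, p ∈ (b p : Set Ω) := fun p => (hB p).2
  have hbeq : ∀ (S : P) p, p ∈ (S : Set Ω) → b p = S := fun S p hp =>
    Subtype.ext (hBuniq p S ⟨S.2, hp⟩).symm
  let _ : MulAction G P :=
    { smul := fun g S => ⟨⇑g.1 '' S, hinv g g.2 S S.2⟩
      one_smul := fun S => Subtype.ext (by simp [HSMul.hSMul])
      mul_smul := fun g h S => Subtype.ext (by simp [HSMul.hSMul, Set.image_image]) }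
  have hsmul : ∀ (g : G) (S : P), ((g • S : P) : Set Ω) = ⇑g.1 '' S := fun _ _ => rfl
  let π : G →* Equiv.Perm P := MulAction.toPermHom G P
  have hπ : ∀ (g : G) (S : P), (π g S : Set Ω) = ⇑g.1 '' S := fun _ _ => rfl
  have hinj : Function.Injective π := by
    rw [injective_iff_map_eq_one]
    intro g hg
    refine Subtype.ext (hfaithful g g.2 fun S hS => ?_)
    rw [← hπ g ⟨S, hS⟩, hg]
    rfl
  have hb : ∀ (g : G) (p : Ω), b (g • p) = π g (b p) := fun g p =>
    hbeq _ _ (by rw [hπ]; exact ⟨p, hbmem p, rfl⟩)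
  have hsurj : b.Surjective := fun S => by
    obtain ⟨p, hp⟩ := Set.nonempty_iff_ne_empty.mpr fun h => hempty (h ▸ S.2)
    exact ⟨p, hbeq S p hp⟩
  have halt' : alternatingGroup P ≤ π.range := fun σ hσ => by
    obtain ⟨g, hg, h⟩ := halt σ hσ
    exact ⟨⟨g, hg⟩, Equiv.ext fun S => Subtype.ext (h S)⟩
  have hninj : ¬ b.Injective := fun h => by
    obtain ⟨S, hS, hne⟩ := hnontriv.1
    exact hne fun p hp q hq => h ((hbeq ⟨S, hS⟩ p hp).trans (hbeq ⟨S, hS⟩ q hq).symm)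
  exact hninj ((crossTransitive_of_card_orbits_le_three hb hrank3.le hninj).injective hinj hb hsurj
    halt' (hcard ▸ hn))
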